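/- arXiv:1811.04619 — 2 statements merged into one kernel-verified Lean document; each statement's English description precedes it below -/
import Mathlib

section
/- Fix λ > 0 and c > 0, and let k(τ, ν) = [ λ^{3/2}·c·ν·(4c − 2τ² − ν²) − 4√λ·c·ν − τ·(4τ² + λ·(4c² − 4cτ² + τ⁴ + τ²ν²)) ] / [ √λ·c·(4(τ²+ν²) + λ·(2c − τ² − ν²)²) ]. Let (τ, ν) : ℝ → ℝ² be a differentiable solution of the system τ' = 1 + k(τ,ν)·ν, ν' = −k(τ,ν)·τ defined on all of ℝ. Then the function r²(s) = τ(s)² + ν(s)² has exactly one critical point s₀ (namely the unique zero of τ), this critical point is a global minimum of r², and r²(s) → +∞ as s → +∞ and as s → −∞. -/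
open Real Filter Set

/-- The curvature function of the planar curve generating a helicoidal vertical translator
with pitch `c` in the Heisenberg group `(Nil₃, g_λ)`, expressed in terms of the support
functions `τ = ⟨γ, T⟩` and `ν = ⟨γ, N⟩`. -/
noncomputable def helicoidalCurvature (lam c τ ν : ℝ) : ℝ :=
  ((Real.sqrt lam) ^ 3 * c * ν * (4 * c - 2 * τ ^ 2 - ν ^ 2) - 4 * Real.sqrt lam * c * ν -
      τ * (4 * τ ^ 2 + lam * (4 * c ^ 2 - 4 * c * τ ^ 2 + τ ^ 4 + τ ^ 2 * ν ^ 2))) /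
    (Real.sqrt lam * c * (4 * (τ ^ 2 + ν ^ 2) + lam * (2 * c - (τ ^ 2 + ν ^ 2)) ^ 2))

/-- `(τ, ν)` is a global solution of the system `τ' = 1 + kν`, `ν' = −kτ`. -/
structure IsHelicoidalSolution (lam c : ℝ) (τ ν : ℝ → ℝ) : Prop where
  tangential : ∀ s, HasDerivAt τ (1 + helicoidalCurvature lam c (τ s) (ν s) * ν s) s
  normal : ∀ s, HasDerivAt ν (-(helicoidalCurvature lam c (τ s) (ν s)) * τ s) s

lemma helicoidalCurvature_neg_neg (lam c τ ν : ℝ) :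
    helicoidalCurvature lam c (-τ) (-ν) = -helicoidalCurvature lam c τ ν := by
  unfold helicoidalCurvature
  rw [← neg_div]
  congr 1 <;> ring

lemma helicoidalCurvature_denom_pos {lam c : ℝ} (hlam : 0 < lam) (hc : 0 < c) (τ ν : ℝ) :
    0 < √lam * c * (4 * (τ ^ 2 + ν ^ 2) + lam * (2 * c - (τ ^ 2 + ν ^ 2)) ^ 2) := by
  have hs : 0 < √lam := Real.sqrt_pos.2 hlam
  have hr : 0 ≤ τ ^ 2 + ν ^ 2 := by positivity
  refine mul_pos (mul_pos hs hc) ?_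
  rcases hr.eq_or_lt with h | h
  · rw [← h]
    have : 0 < lam * (2 * c) ^ 2 := by positivity
    linarith
  · have : 0 ≤ lam * (2 * c - (τ ^ 2 + ν ^ 2)) ^ 2 := by positivity
    linarith

lemma one_add_helicoidalCurvature_mul {lam c : ℝ} (hlam : 0 < lam) (hc : 0 < c) (τ ν : ℝ) :
    1 + helicoidalCurvature lam c τ ν * ν =
      4 * √lam ^ 3 * c ^ 3 /
          (√lam * c * (4 * (τ ^ 2 + ν ^ 2) + lam * (2 * c - (τ ^ 2 + ν ^ 2)) ^ 2)) +
        τ * ((4 * √lam * c * τ + √lam ^ 3 * c * (τ ^ 3 - 4 * c * τ) -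
            ν * (4 * τ ^ 2 + lam * (4 * c ^ 2 - 4 * c * τ ^ 2 + τ ^ 4 + τ ^ 2 * ν ^ 2))) /
          (√lam * c * (4 * (τ ^ 2 + ν ^ 2) + lam * (2 * c - (τ ^ 2 + ν ^ 2)) ^ 2))) := by
  have hD := (helicoidalCurvature_denom_pos hlam hc τ ν).ne'
  have hsq : √lam ^ 2 = lam := Real.sq_sqrt hlam.le
  unfold helicoidalCurvature
  rw [← mul_div_assoc, ← add_div, div_mul_eq_mul_div, eq_div_iff hD, add_mul, div_mul_cancel₀ _ hD]
  linear_combination (-√lam * c * (2 * c - (τ ^ 2 + ν ^ 2)) ^ 2) * hsq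

lemma one_add_helicoidalCurvature_mul_pos {lam c : ℝ} (hlam : 0 < lam) (hc : 0 < c) (ν : ℝ) :
    0 < 1 + helicoidalCurvature lam c 0 ν * ν := by
  have hs : 0 < √lam := Real.sqrt_pos.2 hlam
  rw [one_add_helicoidalCurvature_mul hlam hc, zero_mul, add_zero]
  exact div_pos (by positivity) (helicoidalCurvature_denom_pos hlam hc 0 ν)

lemma exists_sub_mul_abs_le_one_add_helicoidalCurvature_mul {lam c : ℝ} (hlam : 0 < lam)
    (hc : 0 < c) (M : ℝ) :
    ∃ ε > 0, ∃ A : ℝ, ∀ τ ν : ℝ, τ ^ 2 + ν ^ 2 ≤ M →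
      ε - A * |τ| ≤ 1 + helicoidalCurvature lam c τ ν * ν := by
  have hs : 0 < √lam := Real.sqrt_pos.2 hlam
  have hD := helicoidalCurvature_denom_pos hlam hc
  let K : Set (ℝ × ℝ) := Icc (-√M) √M ×ˢ Icc (-√M) √M
  have hK : IsCompact K := isCompact_Icc.prod isCompact_Icc
  let D : ℝ × ℝ → ℝ := fun p =>
    √lam * c * (4 * (p.1 ^ 2 + p.2 ^ 2) + lam * (2 * c - (p.1 ^ 2 + p.2 ^ 2)) ^ 2)
  let P : ℝ × ℝ → ℝ := fun p =>
    4 * √lam * c * p.1 + √lam ^ 3 * c * (p.1 ^ 3 - 4 * c * p.1) -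
      p.2 * (4 * p.1 ^ 2 + lam * (4 * c ^ 2 - 4 * c * p.1 ^ 2 + p.1 ^ 4 + p.1 ^ 2 * p.2 ^ 2))
  have hDpos : ∀ p, 0 < D p := fun p => hD p.1 p.2
  have hDc : Continuous D := by fun_prop
  have hPc : Continuous P := by fun_prop
  obtain ⟨B, hB⟩ := hK.exists_bound_of_continuousOn hDc.continuousOn
  obtain ⟨A, hA⟩ := hK.exists_bound_of_continuousOn
    (hPc.div hDc fun p => (hDpos p).ne').continuousOn
  refine ⟨4 * √lam ^ 3 * c ^ 3 / max B 1, by positivity, A, fun τ ν h => ?_⟩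
  have hmem : (τ, ν) ∈ K :=
    ⟨abs_le.1 (Real.abs_le_sqrt (by nlinarith [sq_nonneg ν])),
      abs_le.1 (Real.abs_le_sqrt (by nlinarith [sq_nonneg τ]))⟩
  have hDB : D (τ, ν) ≤ max B 1 :=
    ((le_abs_self _).trans (hB _ hmem)).trans (le_max_left _ _)
  have hfst : 4 * √lam ^ 3 * c ^ 3 / max B 1 ≤ 4 * √lam ^ 3 * c ^ 3 / D (τ, ν) :=
    div_le_div_of_nonneg_left (by positivity) (hDpos _) hDB
  have hsnd : -(A * |τ|) ≤ τ * (P (τ, ν) / D (τ, ν)) := by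
    have hle : |τ * (P (τ, ν) / D (τ, ν))| ≤ A * |τ| := by
      rw [abs_mul, mul_comm]
      exact mul_le_mul_of_nonneg_right (hA _ hmem) (abs_nonneg τ)
    exact (abs_le.1 hle).1
  rw [one_add_helicoidalCurvature_mul hlam hc]
  exact (sub_eq_add_neg _ _).trans_le (add_le_add hfst hsnd)

namespace IsHelicoidalSolution

variable {lam c : ℝ} {τ ν : ℝ → ℝ}

/-- The system is invariant under reversing the parameter and reflecting in the origin. -/
lemma reverse (h : IsHelicoidalSolution lam c τ ν) :
    IsHelicoidalSolution lam c (fun s => -τ (-s)) (fun s => -ν (-s)) where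
  tangential s := by
    have := ((h.tangential (-s)).comp s (hasDerivAt_neg s)).neg
    rw [helicoidalCurvature_neg_neg]
    exact this.congr_deriv (by ring)
  normal s := by
    have := ((h.normal (-s)).comp s (hasDerivAt_neg s)).neg
    rw [helicoidalCurvature_neg_neg]
    exact this.congr_deriv (by ring)

lemma hasDerivAt_sq_add_sq (h : IsHelicoidalSolution lam c τ ν) (s : ℝ) :
    HasDerivAt (fun s => τ s ^ 2 + ν s ^ 2) (2 * τ s) s :=
  (((h.tangential s).pow 2).add ((h.normal s).pow 2)).congr_deriv (by push_cast; ring)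

/-- On a half-line where `τ` has constant sign `σ`, the squared distance is unbounded. -/
lemma exists_lt_sq_add_sq (h : IsHelicoidalSolution lam c τ ν) (hlam : 0 < lam) (hc : 0 < c)
    {σ a : ℝ} (hσ : ∀ s, a ≤ s → |τ s| = σ * τ s) (M : ℝ) :
    ∃ s, a ≤ s ∧ M < τ s ^ 2 + ν s ^ 2 := by
  by_contra! hM
  obtain ⟨ε, hε, A, hA⟩ := exists_sub_mul_abs_le_one_add_helicoidalCurvature_mul hlam hc M
  let f : ℝ → ℝ := fun s => τ s + A * σ / 2 * (τ s ^ 2 + ν s ^ 2)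
  have hf : ∀ s, HasDerivAt f
      (1 + helicoidalCurvature lam c (τ s) (ν s) * ν s + A * σ / 2 * (2 * τ s)) s :=
    fun s => (h.tangential s).add ((h.hasDerivAt_sq_add_sq s).const_mul _)
  have hgrowth : ∀ s, a ≤ s → ε * (s - a) ≤ f s - f a := fun s hs =>
    (convex_Ici a).mul_sub_le_image_sub_of_le_deriv
      (fun x _ => (hf x).continuousAt.continuousWithinAt)
      (fun x _ => (hf x).differentiableAt.differentiableWithinAt)
      (fun x hx => by
        have hx' : a ≤ x := interior_subset hx
        rw [(hf x).deriv]
        have := hA (τ x) (ν x) (hM x hx')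
        rw [hσ x hx'] at this
        linarith)
      a self_mem_Ici s hs hs
  have hbound : ∀ s, a ≤ s → f s ≤ √M + |A * σ / 2| * M := fun s hs => by
    have hτ : τ s ≤ √M := Real.le_sqrt_of_sq_le (by nlinarith [hM s hs, sq_nonneg (ν s)])
    have hr : A * σ / 2 * (τ s ^ 2 + ν s ^ 2) ≤ |A * σ / 2| * M :=
      mul_le_mul (le_abs_self _) (hM s hs) (by positivity) (abs_nonneg _)
    exact add_le_add hτ hr
  have hB := hbound a le_rfl
  set C := √M + |A * σ / 2| * M
  have hs : a ≤ a + (C - f a + 1) / ε := by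
    have : 0 ≤ (C - f a + 1) / ε := div_nonneg (by linarith) hε.le
    linarith
  have h₁ := hgrowth _ hs
  have h₂ := hbound _ hs
  rw [add_sub_cancel_left, mul_div_cancel₀ _ hε.ne'] at h₁
  linarith

lemma tangential_pos (h : IsHelicoidalSolution lam c τ ν) (hlam : 0 < lam) (hc : 0 < c)
    {a s : ℝ} (ha : τ a = 0) (hs : a < s) : 0 < τ s := by
  have hpos : ∀ x, τ x = 0 → 0 < 1 + helicoidalCurvature lam c (τ x) (ν x) * ν x :=
    fun x hx => hx ▸ one_add_helicoidalCurvature_mul_pos hlam hc (ν x)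
  have hnonneg : ∀ x, a ≤ x → 0 ≤ τ x := fun x hx =>
    image_le_of_deriv_right_lt_deriv_boundary (f := fun _ => 0) (f' := fun _ => 0)
      continuousOn_const (fun y _ => hasDerivWithinAt_const y _ _) ha.ge h.tangential
      (fun y _ hy => hpos y hy.symm) ⟨hx, le_rfl⟩
  refine (hnonneg s hs.le).lt_of_ne fun h0 => ?_
  have hmin : IsLocalMin τ s := by
    filter_upwards [Ici_mem_nhds hs] with x hx
    exact h0 ▸ hnonneg x hx
  exact (hpos s h0.symm).ne' (hmin.hasDerivAt_eq_zero (h.tangential s))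

lemma monotoneOn_sq_add_sq (h : IsHelicoidalSolution lam c τ ν) (hlam : 0 < lam) (hc : 0 < c)
    {a : ℝ} (ha : τ a = 0) : MonotoneOn (fun s => τ s ^ 2 + ν s ^ 2) (Ici a) :=
  monotoneOn_of_deriv_nonneg (convex_Ici a)
    (fun x _ => (h.hasDerivAt_sq_add_sq x).continuousAt.continuousWithinAt)
    (fun x _ => (h.hasDerivAt_sq_add_sq x).differentiableAt.differentiableWithinAt)
    (fun x hx => by
      rw [interior_Ici] at hx
      rw [(h.hasDerivAt_sq_add_sq x).deriv]
      linarith [h.tangential_pos hlam hc ha hx])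

lemma tendsto_sq_add_sq_atTop (h : IsHelicoidalSolution lam c τ ν) (hlam : 0 < lam)
    (hc : 0 < c) {a : ℝ} (ha : τ a = 0) :
    Tendsto (fun s => τ s ^ 2 + ν s ^ 2) atTop atTop := by
  refine tendsto_atTop.2 fun M => ?_
  obtain ⟨b, hab, hb⟩ := h.exists_lt_sq_add_sq hlam hc (σ := 1) (a := a) (fun s hs => by
    rcases hs.eq_or_lt with rfl | hs
    · simp [ha]
    · rw [abs_of_pos (h.tangential_pos hlam hc ha hs), one_mul]) M
  filter_upwards [eventually_ge_atTop b] with s hs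
  exact hb.le.trans (h.monotoneOn_sq_add_sq hlam hc ha hab (hab.trans hs) hs)

lemma exists_nonneg (h : IsHelicoidalSolution lam c τ ν) (hlam : 0 < lam) (hc : 0 < c) :
    ∃ s, 0 ≤ τ s := by
  by_contra! hneg
  have hanti : Antitone fun s => τ s ^ 2 + ν s ^ 2 :=
    antitone_of_deriv_nonpos (fun s => (h.hasDerivAt_sq_add_sq s).differentiableAt) fun s => by
      rw [(h.hasDerivAt_sq_add_sq s).deriv]
      linarith [hneg s]
  obtain ⟨s, hs, hlt⟩ := h.exists_lt_sq_add_sq hlam hc (σ := -1) (a := 0)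
    (fun s _ => by rw [abs_of_neg (hneg s), neg_one_mul]) (τ 0 ^ 2 + ν 0 ^ 2)
  exact hlt.not_ge (hanti hs)

lemma exists_tangential_eq_zero (h : IsHelicoidalSolution lam c τ ν) (hlam : 0 < lam)
    (hc : 0 < c) : ∃ s, τ s = 0 := by
  obtain ⟨x, hx⟩ := h.exists_nonneg hlam hc
  obtain ⟨y, hy⟩ := h.reverse.exists_nonneg hlam hc
  exact mem_range_of_exists_le_of_exists_ge
    (continuous_iff_continuousAt.2 fun s => (h.tangential s).continuousAt)
    ⟨-y, neg_nonneg.1 hy⟩ ⟨x, hx⟩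

end IsHelicoidalSolution

/-- Along a global solution of `τ' = 1 + kν`, `ν' = −kτ`, the squared distance
`r² = τ² + ν²` has exactly one critical point (the unique zero of `τ`), which is a global
minimum, and `r² → ∞` in both directions. -/
theorem helicoidal_r_squared_behaviour
    (lam c : ℝ) (hlam : 0 < lam) (hc : 0 < c) (τ ν : ℝ → ℝ)
    (hτ : ∀ s : ℝ, HasDerivAt τ (1 + helicoidalCurvature lam c (τ s) (ν s) * ν s) s)
    (hν : ∀ s : ℝ, HasDerivAt ν (-(helicoidalCurvature lam c (τ s) (ν s)) * τ s) s) :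
    ∃ s₀ : ℝ, τ s₀ = 0 ∧ (∀ s : ℝ, τ s = 0 → s = s₀) ∧
      (∀ s : ℝ, (τ s₀) ^ 2 + (ν s₀) ^ 2 ≤ (τ s) ^ 2 + (ν s) ^ 2) ∧
      Filter.Tendsto (fun s : ℝ => (τ s) ^ 2 + (ν s) ^ 2) Filter.atTop Filter.atTop ∧
      Filter.Tendsto (fun s : ℝ => (τ s) ^ 2 + (ν s) ^ 2) Filter.atBot Filter.atTop := by
  have h : IsHelicoidalSolution lam c τ ν := ⟨hτ, hν⟩
  obtain ⟨s₀, hs₀⟩ := h.exists_tangential_eq_zero hlam hc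
  have hrev : (fun s => -τ (-s)) (-s₀) = 0 := by simp [hs₀]
  refine ⟨s₀, hs₀, fun s hs => ?_, fun s => ?_, h.tendsto_sq_add_sq_atTop hlam hc hs₀, ?_⟩
  · rcases lt_trichotomy s s₀ with hlt | heq | hlt
    · exact absurd hs₀ (h.tangential_pos hlam hc hs hlt).ne'
    · exact heq
    · exact absurd hs (h.tangential_pos hlam hc hs₀ hlt).ne'
  · rcases le_total s₀ s with hle | hle
    · exact h.monotoneOn_sq_add_sq hlam hc hs₀ self_mem_Ici hle hle
    · simpa using h.reverse.monotoneOn_sq_add_sq hlam hc hrev self_mem_Ici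
        (neg_le_neg hle) (neg_le_neg hle)
  · simpa [Function.comp_def] using
      (h.reverse.tendsto_sq_add_sq_atTop hlam hc hrev).comp tendsto_neg_atBot_atTop
end

section
/- Fix λ > 0 and c > 0, and let k(τ, ν) = [ λ^{3/2}·c·ν·(4c − 2τ² − ν²) − 4√λ·c·ν − τ·(4τ² + λ·(4c² − 4cτ² + τ⁴ + τ²ν²)) ] / [ √λ·c·(4(τ²+ν²) + λ·(2c − τ² − ν²)²) ]. Let (τ, ν) : ℝ → ℝ² be a differentiable solution of the system τ' = 1 + k(τ,ν)·ν, ν' = −k(τ,ν)·τ defined on all of ℝ. Then τ converges to a finite limit as s → +∞ and to a finite limit as s → −∞, while ν(s) → +∞ as s → +∞ and ν(s) → −∞ as s → −∞. -/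
open Real Filter Set

/-- The common denominator factor of the support function system. -/
noncomputable def supportDenom (l c x y : ℝ) : ℝ :=
  4 * (x ^ 2 + y ^ 2) + l * (2 * c - (x ^ 2 + y ^ 2)) ^ 2

/-- The value of `supportDenom` on the axis `y = 0`. -/
noncomputable def supportAxis (l c x : ℝ) : ℝ := 4 * x ^ 2 + l * (2 * c - x ^ 2) ^ 2

/-- The derivative of the tangential support function, with `m = √λ c`. -/
noncomputable def tauVelocity (l c m x y : ℝ) : ℝ :=
  (m * supportAxis l c x - x * y * (supportAxis l c x + l * (x * y) ^ 2)) /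
    (m * supportDenom l c x y)

/-- The derivative of the normal support function, with `m = √λ c`. -/
noncomputable def nuVelocity (l c m x y : ℝ) : ℝ :=
  (x ^ 2 * (supportAxis l c x + l * (x * y) ^ 2) +
      m * (x * y) * (4 - 4 * c * l + l * (2 * x ^ 2 + y ^ 2))) /
    (m * supportDenom l c x y)

section Calculus

theorem le_of_hasDerivAt_nonneg {f f' : ℝ → ℝ} {s₀ : ℝ}
    (hf : ∀ s, s₀ ≤ s → HasDerivAt f (f' s) s) (h : ∀ s, s₀ ≤ s → 0 ≤ f' s)
    {s t : ℝ} (hs : s₀ ≤ s) (hst : s ≤ t) : f s ≤ f t := by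
  have hm : MonotoneOn f (Ici s₀) := by
    refine monotoneOn_of_deriv_nonneg (convex_Ici s₀)
      (fun r hr => (hf r hr).continuousAt.continuousWithinAt) ?_ ?_
    · intro r hr
      rw [interior_Ici] at hr
      exact (hf r (le_of_lt hr)).differentiableAt.differentiableWithinAt
    · intro r hr
      rw [interior_Ici] at hr
      rw [(hf r (le_of_lt hr)).deriv]
      exact h r (le_of_lt hr)
  exact hm hs (hs.trans hst : s₀ ≤ t) hst

theorem exists_lt_of_le_hasDerivAt {f f' : ℝ → ℝ} {s₀ δ : ℝ} (hδ : 0 < δ)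
    (hf : ∀ s, s₀ ≤ s → HasDerivAt f (f' s) s) (h : ∀ s, s₀ ≤ s → δ ≤ f' s) (B : ℝ) :
    ∃ s, s₀ ≤ s ∧ B < f s := by
  have hb : s₀ ≤ s₀ + (|B - f s₀| + 1) / δ := le_add_of_nonneg_right (by positivity)
  refine ⟨_, hb, ?_⟩
  have := le_of_hasDerivAt_nonneg (f := fun s => f s - δ * s) (f' := fun s => f' s - δ * 1)
    (fun s hs => (hf s hs).sub ((hasDerivAt_id s).const_mul δ))
    (fun s hs => by linarith [h s hs]) le_rfl hb
  have h2 : δ * (s₀ + (|B - f s₀| + 1) / δ) = δ * s₀ + (|B - f s₀| + 1) := by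
    field_simp
  rw [h2] at this
  linarith [le_abs_self (B - f s₀)]

/-- A level that a function can only cross upwards is a lower barrier. -/
theorem le_of_hasDerivAt_pos_of_eq {f f' : ℝ → ℝ} {s₀ b : ℝ}
    (hf : ∀ s, s₀ ≤ s → HasDerivAt f (f' s) s) (h₀ : b ≤ f s₀)
    (h : ∀ s, s₀ ≤ s → f s = b → 0 < f' s) {s : ℝ} (hs : s₀ ≤ s) : b ≤ f s := by
  exact image_le_of_deriv_right_lt_deriv_boundary' (f := fun _ => b) (f' := fun _ => 0)
    (a := s₀) (b := s) (B := f) (B' := f') continuousOn_const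
    (fun r _ => (hasDerivAt_const r b).hasDerivWithinAt) h₀
    (fun r hr => (hf r hr.1).continuousAt.continuousWithinAt)
    (fun r hr => (hf r hr.1).hasDerivWithinAt)
    (fun r hr e => h r hr.1 e.symm) (right_mem_Icc.2 hs)

theorem lt_of_hasDerivAt_pos_of_eq {f f' : ℝ → ℝ} {s₀ b : ℝ}
    (hf : ∀ s, s₀ ≤ s → HasDerivAt f (f' s) s) (h₀ : b ≤ f s₀)
    (h : ∀ s, s₀ ≤ s → f s = b → 0 < f' s) {s : ℝ} (hs : s₀ < s) : b < f s := by
  refine lt_of_le_of_ne (le_of_hasDerivAt_pos_of_eq hf h₀ h hs.le) fun e => ?_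
  have hmin : IsLocalMin f s := by
    filter_upwards [Ioi_mem_nhds hs] with r hr
    rw [← e]
    exact le_of_hasDerivAt_pos_of_eq hf h₀ h (le_of_lt hr)
  exact (h s hs.le e.symm).ne' (hmin.hasDerivAt_eq_zero (hf s hs.le))

end Calculus

section Velocity

variable {l c m : ℝ}

theorem supportAxis_pos (hl : 0 < l) (hc : 0 < c) (x : ℝ) : 0 < supportAxis l c x := by
  unfold supportAxis
  rcases eq_or_ne x 0 with rfl | hx
  · norm_num; positivity
  · positivity

theorem supportDenom_pos (hl : 0 < l) (hc : 0 < c) (x y : ℝ) : 0 < supportDenom l c x y := by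
  unfold supportDenom
  rcases eq_or_lt_of_le (by positivity : 0 ≤ x ^ 2 + y ^ 2) with h | h
  · rw [← h]; norm_num; positivity
  · positivity

theorem supportDenom_le (hl : 0 < l) (hc : 0 < c) {x y : ℝ} (h : 1 ≤ x ^ 2 + y ^ 2) :
    supportDenom l c x y ≤ (4 + l * (4 * c ^ 2 + 1)) * (x ^ 2 + y ^ 2) ^ 2 := by
  unfold supportDenom
  generalize x ^ 2 + y ^ 2 = u at *
  have h1 : u ≤ u ^ 2 := by nlinarith
  have h2 : (2 * c - u) ^ 2 ≤ (4 * c ^ 2 + 1) * u ^ 2 := by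
    nlinarith [mul_pos hc (by linarith : 0 < u), mul_nonneg (sq_nonneg c) (by linarith : 0 ≤ u ^ 2 - 1)]
  nlinarith [mul_le_mul_of_nonneg_left h2 hl.le]

theorem mul_tauVelocity_add_mul_nuVelocity (hl : 0 < l) (hc : 0 < c) (hm : 0 < m) (x y : ℝ) :
    x * tauVelocity l c m x y + y * nuVelocity l c m x y = x := by
  have hD := supportDenom_pos hl hc x y
  unfold tauVelocity nuVelocity
  field_simp
  unfold supportAxis supportDenom
  ring

theorem tauVelocity_pos (hl : 0 < l) (hc : 0 < c) (hm : 0 < m) {x y : ℝ} (h : x * y ≤ 0) :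
    0 < tauVelocity l c m x y := by
  have hD := supportDenom_pos hl hc x y
  have hQ := supportAxis_pos hl hc x
  unfold tauVelocity
  refine div_pos ?_ (by positivity)
  have : 0 ≤ -(x * y) * (supportAxis l c x + l * (x * y) ^ 2) :=
    mul_nonneg (by linarith) (by positivity)
  nlinarith [mul_pos hm hQ]

theorem nuVelocity_pos (hl : 0 < l) (hc : 0 < c) (hm : 0 < m) {x : ℝ} (hx : 0 < x) :
    0 < nuVelocity l c m x 0 := by
  have hD := supportDenom_pos hl hc x 0
  have hQ := supportAxis_pos hl hc x
  unfold nuVelocity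
  refine div_pos ?_ (by positivity)
  simp only [mul_zero, zero_mul, add_zero]
  positivity

theorem nuVelocity_nonneg (hl : 0 < l) (hc : 0 < c) (hm : 0 < m) {x y : ℝ} (hx : 0 < x)
    (hy : 0 < y) (h : 4 * c ≤ x ^ 2 + y ^ 2) : 0 ≤ nuVelocity l c m x y := by
  have hD := supportDenom_pos hl hc x y
  have hQ := supportAxis_pos hl hc x
  unfold nuVelocity
  refine div_nonneg (add_nonneg (by positivity) (mul_nonneg (by positivity) ?_)) (by positivity)
  nlinarith [mul_nonneg hl.le (by linarith : 0 ≤ x ^ 2 + y ^ 2 - 4 * c),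
    mul_nonneg hl.le (sq_nonneg x)]

theorem exists_le_tauVelocity (hl : 0 < l) (hc : 0 < c) (hm : 0 < m) (R : ℝ) :
    ∃ ε > 0, ∃ δ > 0, ∀ x y : ℝ, |x| ≤ ε → x ^ 2 + y ^ 2 ≤ R → δ ≤ tauVelocity l c m x y := by
  obtain ⟨η, hη, hη1, hη2⟩ : ∃ η > 0, η ≤ m / 2 ∧ η ^ 3 ≤ m * c ^ 2 / 4 := by
    refine ⟨min 1 (min (m / 2) (m * c ^ 2 / 4)), by positivity, by simp, ?_⟩
    set η := min 1 (min (m / 2) (m * c ^ 2 / 4)) with h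
    have h0 : 0 < η := by positivity
    have h1 : η ≤ 1 := min_le_left _ _
    have h2 : η ≤ m * c ^ 2 / 4 := (min_le_right _ _).trans (min_le_right _ _)
    have : η ^ 3 ≤ η := pow_le_of_le_one h0.le h1 (by norm_num)
    linarith
  set S := |R| + 1 with hS
  have hS1 : 1 ≤ S := by simp [hS]
  have hRS : R ≤ S := by linarith [le_abs_self R]
  set C := 4 * S + l * (4 * c ^ 2 + S ^ 2) with hC
  have hC0 : 0 < C := by positivity
  refine ⟨min (min 1 c) (η / S), by positivity, l * c ^ 2 / 4 / C, by positivity, ?_⟩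
  intro x y hx hR
  have hx1 : |x| ≤ 1 := hx.trans ((min_le_left _ _).trans (min_le_left _ _))
  have hxc : |x| ≤ c := hx.trans ((min_le_left _ _).trans (min_le_right _ _))
  have hxη : |x| ≤ η / S := hx.trans (min_le_right _ _)
  have hy : |y| ≤ S := by
    refine abs_le_of_sq_le_sq ?_ (by linarith)
    nlinarith [sq_nonneg x]
  have hp : |x * y| ≤ η := by
    rw [abs_mul]
    calc |x| * |y| ≤ η / S * S := by gcongr
      _ = η := by field_simp
  have hx2 : x ^ 2 ≤ c := by
    rw [← sq_abs]; nlinarith [abs_nonneg x]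
  have hQ : l * c ^ 2 ≤ supportAxis l c x := by
    unfold supportAxis
    have : c ^ 2 ≤ (2 * c - x ^ 2) ^ 2 := by nlinarith
    nlinarith [mul_le_mul_of_nonneg_left this hl.le, sq_nonneg x]
  have hD := supportDenom_pos hl hc x y
  have hDC : supportDenom l c x y ≤ C := by
    unfold supportDenom
    have hu : x ^ 2 + y ^ 2 ≤ S := hR.trans hRS
    have hu0 : 0 ≤ x ^ 2 + y ^ 2 := by positivity
    generalize x ^ 2 + y ^ 2 = u at *
    have : (2 * c - u) ^ 2 ≤ 4 * c ^ 2 + S ^ 2 := by nlinarith [mul_nonneg hc.le hu0]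
    nlinarith [mul_le_mul_of_nonneg_left this hl.le]
  have hp3 : (x * y) ^ 3 ≤ η ^ 3 := by
    calc (x * y) ^ 3 ≤ |(x * y) ^ 3| := le_abs_self _
      _ = |x * y| ^ 3 := abs_pow _ _
      _ ≤ η ^ 3 := by gcongr
  have hp1 : x * y ≤ m / 2 := (le_abs_self _).trans (hp.trans hη1)
  have key : m * (l * c ^ 2 / 4) ≤
      m * supportAxis l c x - x * y * (supportAxis l c x + l * (x * y) ^ 2) := by
    have e : x * y * (supportAxis l c x + l * (x * y) ^ 2) =
      x * y * supportAxis l c x + l * (x * y) ^ 3 := by ring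
    rw [e]
    have h0 : 0 < supportAxis l c x := supportAxis_pos hl hc x
    have h1 := mul_le_mul_of_nonneg_right hp1 h0.le
    have h2 := mul_le_mul_of_nonneg_left (hp3.trans hη2) hl.le
    have h3 := mul_le_mul_of_nonneg_left hQ hm.le
    nlinarith
  unfold tauVelocity
  rw [div_le_div_iff₀ hC0 (by positivity)]
  calc l * c ^ 2 / 4 * (m * supportDenom l c x y) ≤ l * c ^ 2 / 4 * (m * C) := by gcongr
    _ = m * (l * c ^ 2 / 4) * C := by ring
    _ ≤ _ := by gcongr

theorem exists_le_nuVelocity (hl : 0 < l) (hc : 0 < c) (hm : 0 < m) :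
    ∃ X > 0, ∃ δ > 0, ∀ x y : ℝ, X ≤ x → |y| ≤ x → δ ≤ nuVelocity l c m x y := by
  set C := 4 + l * (4 * c ^ 2 + 1) with hC
  have hC0 : 0 < C := by positivity
  set K := m * (4 + 4 * c * l + 3 * l) with hK
  have hK0 : 0 < K := by positivity
  refine ⟨1 + 8 * c + 4 * K / l, by positivity, l / (16 * m * C), by positivity, ?_⟩
  intro x y hX hy
  have hKl : 0 < 4 * K / l := by positivity
  have hx1 : 1 ≤ x := by linarith
  have hx0 : 0 < x := by linarith
  have hy2 : y ^ 2 ≤ x ^ 2 := by rw [← sq_abs y]; gcongr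
  have hxy : |x * y| ≤ x ^ 2 := by
    rw [abs_mul, abs_of_pos hx0, sq]; gcongr
  have hD := supportDenom_pos hl hc x y
  have hDC : supportDenom l c x y ≤ C * (2 * x ^ 2) ^ 2 := by
    refine (supportDenom_le hl hc (by nlinarith)).trans ?_
    gcongr
    linarith
  have ht1 : 1 ≤ x ^ 2 := by nlinarith
  have htc : 8 * c ≤ x ^ 2 := by nlinarith
  have htK : 4 * K ≤ l * x ^ 2 := by
    have : 4 * K / l ≤ x ^ 2 := by nlinarith
    rw [div_le_iff₀ hl] at this
    linarith
  have hfac : |4 - 4 * c * l + l * (2 * x ^ 2 + y ^ 2)| ≤ (4 + 4 * c * l + 3 * l) * x ^ 2 := by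
    have h1 := mul_le_mul_of_nonneg_left hy2 hl.le
    have h2 : 0 < c * l := by positivity
    have h3 := mul_nonneg h2.le (by linarith : 0 ≤ x ^ 2 - 1)
    have h4 := mul_nonneg hl.le (sq_nonneg y)
    have h5 := mul_nonneg hl.le (sq_nonneg x)
    rw [abs_le]
    constructor <;> nlinarith
  have hcross : -(K * (x ^ 2) ^ 2) ≤
      m * (x * y) * (4 - 4 * c * l + l * (2 * x ^ 2 + y ^ 2)) := by
    refine neg_le_of_abs_le ?_
    rw [abs_mul, abs_mul, abs_of_pos hm]
    calc m * |x * y| * |4 - 4 * c * l + l * (2 * x ^ 2 + y ^ 2)|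
        ≤ m * x ^ 2 * ((4 + 4 * c * l + 3 * l) * x ^ 2) := by gcongr
      _ = K * (x ^ 2) ^ 2 := by rw [hK]; ring
  have hQ : l * ((x ^ 2) ^ 2 / 2) ≤ supportAxis l c x + l * (x * y) ^ 2 := by
    unfold supportAxis
    have : (x ^ 2) ^ 2 / 2 ≤ (2 * c - x ^ 2) ^ 2 := by
      have : 3 / 4 * x ^ 2 ≤ x ^ 2 - 2 * c := by linarith
      nlinarith
    have h1 := mul_le_mul_of_nonneg_left this hl.le
    have h2 : 0 ≤ l * (x * y) ^ 2 := by positivity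
    nlinarith
  have key : l * (x ^ 2) ^ 3 / 4 ≤ x ^ 2 * (supportAxis l c x + l * (x * y) ^ 2) +
      m * (x * y) * (4 - 4 * c * l + l * (2 * x ^ 2 + y ^ 2)) := by
    have h1 := mul_le_mul_of_nonneg_left hQ (sq_nonneg x)
    have h2 := mul_le_mul_of_nonneg_right htK (sq_nonneg (x ^ 2))
    linarith
  unfold nuVelocity
  rw [div_le_div_iff₀ (by positivity) (by positivity)]
  calc l * (m * supportDenom l c x y) ≤ l * (m * (C * (2 * x ^ 2) ^ 2)) := by gcongr
    _ = l * (x ^ 2) ^ 2 * 1 / 4 * (16 * m * C) := by ring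
    _ ≤ l * (x ^ 2) ^ 2 * x ^ 2 / 4 * (16 * m * C) := by gcongr
    _ = l * (x ^ 2) ^ 3 / 4 * (16 * m * C) := by ring
    _ ≤ _ := by gcongr

/-- A lower bound for `|τ'| / τ²` in the region `|ν| ≥ τ` by a multiple of the logarithmic
derivative of `τ² + ν²`. -/
theorem le_div_supportDenom (hl : 0 < l) (hc : 0 < c) (hm : 0 < m) {x z : ℝ} (hx : 0 < x)
    (hz : 1 ≤ z) (hxz : x ≤ z) :
    l / (4 * m * (4 + l * (4 * c ^ 2 + 1))) * (2 * x / (x ^ 2 + z ^ 2)) ≤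
      l * (x * z) ^ 3 / (m * supportDenom l c x z) / x ^ 2 := by
  have hD := supportDenom_pos hl hc x z
  have hu : 1 ≤ x ^ 2 + z ^ 2 := by nlinarith
  have hDC := supportDenom_le hl hc hu
  have hz3 : (x ^ 2 + z ^ 2) / 2 ≤ z ^ 3 := by
    have : z ^ 2 ≤ z ^ 3 := by nlinarith [sq_nonneg z]
    nlinarith
  set C := 4 + l * (4 * c ^ 2 + 1) with hC
  have hC0 : 0 < C := by positivity
  have e1 : l / (4 * m * C) * (2 * x / (x ^ 2 + z ^ 2)) =
      l * x * ((x ^ 2 + z ^ 2) / 2) / (m * (C * (x ^ 2 + z ^ 2) ^ 2)) := by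
    have : 0 < x ^ 2 + z ^ 2 := by linarith
    field_simp
    ring
  have e2 : l * (x * z) ^ 3 / (m * supportDenom l c x z) / x ^ 2 =
      l * x * z ^ 3 / (m * supportDenom l c x z) := by
    field_simp
  rw [e1, e2]
  gcongr

theorem le_tauVelocity_of_nonpos (hl : 0 < l) (hc : 0 < c) (hm : 0 < m) {x z : ℝ}
    (h : 0 ≤ x * z) :
    l * (x * z) ^ 3 / (m * supportDenom l c x z) ≤ tauVelocity l c m x (-z) := by
  have hD := supportDenom_pos hl hc x z
  have hQ := supportAxis_pos hl hc x
  have e : supportDenom l c x (-z) = supportDenom l c x z := by unfold supportDenom; ring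
  unfold tauVelocity
  rw [e]
  gcongr
  nlinarith [mul_pos hm hQ, mul_nonneg h hQ.le]

theorem tauVelocity_le_of_le_mul (hl : 0 < l) (hc : 0 < c) (hm : 0 < m) {x z : ℝ}
    (h : m ≤ x * z) :
    tauVelocity l c m x z ≤ -(l * (x * z) ^ 3 / (m * supportDenom l c x z)) := by
  have hD := supportDenom_pos hl hc x z
  have hQ := supportAxis_pos hl hc x
  unfold tauVelocity
  rw [← neg_div]
  gcongr
  nlinarith [mul_nonneg (by linarith : 0 ≤ x * z - m) hQ.le]

end Velocity

section Solution

variable {l c m : ℝ} {x y : ℝ → ℝ}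

theorem hasDerivAt_sq_add_sq (hl : 0 < l) (hc : 0 < c) (hm : 0 < m)
    (hx : ∀ s, HasDerivAt x (tauVelocity l c m (x s) (y s)) s)
    (hy : ∀ s, HasDerivAt y (nuVelocity l c m (x s) (y s)) s) (s : ℝ) :
    HasDerivAt (fun s => x s ^ 2 + y s ^ 2) (2 * x s) s := by
  have h := ((hx s).pow 2).add ((hy s).pow 2)
  have e := mul_tauVelocity_add_mul_nuVelocity hl hc hm (x s) (y s)
  refine h.congr_deriv ?_
  simp only [Nat.cast_ofNat, Nat.reduceSub, pow_one]
  linarith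

theorem exists_tau_pos (hl : 0 < l) (hc : 0 < c) (hm : 0 < m)
    (hx : ∀ s, HasDerivAt x (tauVelocity l c m (x s) (y s)) s)
    (hy : ∀ s, HasDerivAt y (nuVelocity l c m (x s) (y s)) s) : ∃ s, 0 < x s := by
  by_contra! hneg
  have hu := hasDerivAt_sq_add_sq hl hc hm hx hy
  have hR : ∀ s, 0 ≤ s → x s ^ 2 + y s ^ 2 ≤ x 0 ^ 2 + y 0 ^ 2 := fun s hs => by
    have := le_of_hasDerivAt_nonneg (f := fun s => -(x s ^ 2 + y s ^ 2)) (s₀ := 0)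
      (fun s _ => (hu s).neg) (fun s _ => by linarith [hneg s]) le_rfl hs
    linarith
  obtain ⟨ε, hε, δ, hδ, hF⟩ := exists_le_tauVelocity hl hc hm (x 0 ^ 2 + y 0 ^ 2)
  by_cases h : ∃ s, 0 ≤ s ∧ -ε ≤ x s
  · obtain ⟨s₁, hs₁, hxs⟩ := h
    have hb : ∀ s, s₁ ≤ s → -ε ≤ x s := fun s hs =>
      le_of_hasDerivAt_pos_of_eq (fun s _ => hx s) hxs (fun s hs e => hδ.trans_le
        (hF _ _ (by rw [e, abs_neg, abs_of_pos hε]) (hR s (hs₁.trans hs)))) hs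
    obtain ⟨s, -, h⟩ := exists_lt_of_le_hasDerivAt hδ (s₀ := s₁) (fun s _ => hx s)
      (fun s hs => hF _ _ (abs_le.2 ⟨hb s hs, (hneg s).trans hε.le⟩) (hR s (hs₁.trans hs))) 0
    exact absurd h (hneg s).not_gt
  · push Not at h
    obtain ⟨s, -, hs⟩ := exists_lt_of_le_hasDerivAt (f := fun s => -(x s ^ 2 + y s ^ 2))
      (by positivity : 0 < 2 * ε) (s₀ := 0) (fun s _ => (hu s).neg)
      (fun s hs => by linarith [h s hs]) 0
    nlinarith [sq_nonneg (x s), sq_nonneg (y s)]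

theorem tendsto_sq_add_sq (hl : 0 < l) (hc : 0 < c) (hm : 0 < m)
    (hx : ∀ s, HasDerivAt x (tauVelocity l c m (x s) (y s)) s)
    (hy : ∀ s, HasDerivAt y (nuVelocity l c m (x s) (y s)) s) {s₀ : ℝ}
    (hpos : ∀ s, s₀ ≤ s → 0 < x s) :
    Tendsto (fun s => x s ^ 2 + y s ^ 2) atTop atTop := by
  have hu := hasDerivAt_sq_add_sq hl hc hm hx hy
  have hmono : ∀ s t, s₀ ≤ s → s ≤ t → x s ^ 2 + y s ^ 2 ≤ x t ^ 2 + y t ^ 2 :=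
    fun s t hs hst => le_of_hasDerivAt_nonneg (f := fun s => x s ^ 2 + y s ^ 2)
      (fun s _ => hu s) (fun s hs => by linarith [hpos s hs]) hs hst
  refine tendsto_atTop.2 fun B => ?_
  obtain ⟨s₁, hs₁, hB⟩ : ∃ s, s₀ ≤ s ∧ B ≤ x s ^ 2 + y s ^ 2 := by
    by_contra! hcon
    obtain ⟨ε, hε, δ, hδ, hF⟩ := exists_le_tauVelocity hl hc hm B
    have hμ : 0 < min (x s₀) ε := lt_min (hpos s₀ le_rfl) hε
    have hb : ∀ s, s₀ ≤ s → min (x s₀) ε ≤ x s := fun s hs =>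
      le_of_hasDerivAt_pos_of_eq (fun s _ => hx s) (min_le_left _ _) (fun s hs e => hδ.trans_le
        (hF _ _ (by rw [e, abs_of_pos hμ]; exact min_le_right _ _) (hcon s hs).le)) hs
    obtain ⟨s, hs, h⟩ := exists_lt_of_le_hasDerivAt (f := fun s => x s ^ 2 + y s ^ 2)
      (by positivity : 0 < 2 * min (x s₀) ε) (fun s _ => hu s)
      (fun s hs => by linarith [hb s hs]) B
    exact (hcon s hs).not_gt h
  filter_upwards [eventually_ge_atTop s₁] with s hs
  exact hB.trans (hmono _ _ hs₁ hs)

theorem hasDerivAt_log_sq_add_sq (hl : 0 < l) (hc : 0 < c) (hm : 0 < m)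
    (hx : ∀ s, HasDerivAt x (tauVelocity l c m (x s) (y s)) s)
    (hy : ∀ s, HasDerivAt y (nuVelocity l c m (x s) (y s)) s) {s : ℝ} (hs : 0 < x s) :
    HasDerivAt (fun s => Real.log (x s ^ 2 + y s ^ 2)) (2 * x s / (x s ^ 2 + y s ^ 2)) s :=
  (hasDerivAt_sq_add_sq hl hc hm hx hy s).log (by positivity)

theorem exists_nu_nonneg (hl : 0 < l) (hc : 0 < c) (hm : 0 < m)
    (hx : ∀ s, HasDerivAt x (tauVelocity l c m (x s) (y s)) s)
    (hy : ∀ s, HasDerivAt y (nuVelocity l c m (x s) (y s)) s) {s₀ : ℝ}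
    (hpos : ∀ s, s₀ ≤ s → 0 < x s) : ∃ s, s₀ ≤ s ∧ 0 ≤ y s := by
  by_contra! hneg
  have hinf := tendsto_sq_add_sq hl hc hm hx hy hpos
  have hx' : ∀ s, s₀ ≤ s → 0 < tauVelocity l c m (x s) (y s) := fun s hs =>
    tauVelocity_pos hl hc hm (mul_nonpos_of_nonneg_of_nonpos (hpos s hs).le (hneg s hs).le)
  obtain ⟨X, hX, δ, hδ, hF⟩ := exists_le_nuVelocity hl hc hm
  obtain ⟨s₁, hs₁⟩ := eventually_atTop.1 ((hinf.eventually_ge_atTop (2 + 2 * X ^ 2)).and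
    (eventually_ge_atTop s₀))
  obtain ⟨s₂, hs₂, hxy⟩ : ∃ s, s₁ ≤ s ∧ -y s ≤ x s := by
    by_contra! hcon
    set κ := l / (4 * m * (4 + l * (4 * c ^ 2 + 1))) with hκ
    have hκ0 : 0 < κ := by positivity
    have hmono : ∀ s, s₁ ≤ s →
        -(x s₁)⁻¹ - κ * Real.log (x s₁ ^ 2 + y s₁ ^ 2) ≤
          -(x s)⁻¹ - κ * Real.log (x s ^ 2 + y s ^ 2) := fun s hs =>
      le_of_hasDerivAt_nonneg (f := fun s => -(x s)⁻¹ - κ * Real.log (x s ^ 2 + y s ^ 2))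
        (fun s hs => (((hx s).inv (hpos s (hs₁ s hs).2).ne').neg).sub
          ((hasDerivAt_log_sq_add_sq hl hc hm hx hy (hpos s (hs₁ s hs).2)).const_mul κ))
        (fun s hs => by
          have hp := hpos s (hs₁ s hs).2
          have hxz := hcon s hs
          have hz : 1 ≤ -y s := by nlinarith [(hs₁ s hs).1, sq_nonneg X]
          have h1 := le_div_supportDenom hl hc hm hp hz hxz.le
          have h2 := le_tauVelocity_of_nonpos hl hc hm (x := x s) (z := -y s)
            (mul_nonneg hp.le (by linarith))
          rw [neg_neg] at h2
          have h3 := div_le_div_of_nonneg_right h2 (sq_nonneg (x s))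
          rw [neg_sq] at h1
          rw [neg_div, neg_neg]
          linarith) le_rfl hs
    have hlog := (Real.tendsto_log_atTop.comp hinf).const_mul_atTop hκ0
    obtain ⟨s, hs, hss⟩ := ((hlog.eventually_gt_atTop
      ((x s₁)⁻¹ + κ * Real.log (x s₁ ^ 2 + y s₁ ^ 2))).and (eventually_ge_atTop s₁)).exists
    have h1 := hmono s hss
    have h2 := inv_pos.2 (hpos s (hs₁ s hss).2)
    simp only [Function.comp] at hs
    linarith
  have hs₀₂ : s₀ ≤ s₂ := (hs₁ s₂ hs₂).2
  have hX₂ : X ≤ x s₂ := by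
    have h1 := (hs₁ s₂ hs₂).1
    have h2 := hneg s₂ hs₀₂
    have h3 := hpos s₂ hs₀₂
    nlinarith
  have hXs : ∀ s, s₂ ≤ s → X ≤ x s := fun s hs => hX₂.trans
    (le_of_hasDerivAt_nonneg (fun s _ => hx s) (fun s hs => (hx' s hs).le) hs₀₂ hs)
  have hsum : ∀ s, s₂ ≤ s → 0 ≤ x s + y s := fun s hs =>
    le_of_hasDerivAt_pos_of_eq (f := fun s => x s + y s) (fun s _ => (hx s).add (hy s))
      (by linarith) (fun s hs e => by
        have h1 := hx' s (hs₀₂.trans hs)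
        have h2 := hF (x s) (y s) (hXs s hs)
          (abs_le.2 ⟨by linarith, by linarith [hneg s (hs₀₂.trans hs), hpos s (hs₀₂.trans hs)]⟩)
        linarith) hs
  obtain ⟨s, hs, h⟩ := exists_lt_of_le_hasDerivAt hδ (s₀ := s₂) (fun s _ => hy s)
    (fun s hs => hF _ _ (hXs s hs) (abs_le.2 ⟨by linarith [hsum s hs],
      by linarith [hneg s (hs₀₂.trans hs), hpos s (hs₀₂.trans hs)]⟩)) 0
  exact (hneg s (hs₀₂.trans hs)).not_gt h

theorem tendsto_nu_of_pos (hl : 0 < l) (hc : 0 < c) (hm : 0 < m)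
    (hx : ∀ s, HasDerivAt x (tauVelocity l c m (x s) (y s)) s)
    (hy : ∀ s, HasDerivAt y (nuVelocity l c m (x s) (y s)) s) {s₀ : ℝ}
    (hpos : ∀ s, s₀ ≤ s → 0 < x s) (hypos : ∀ s, s₀ ≤ s → 0 < y s) :
    Tendsto y atTop atTop := by
  have hinf := tendsto_sq_add_sq hl hc hm hx hy hpos
  obtain ⟨s₁, hs₁⟩ := eventually_atTop.1 ((hinf.eventually_ge_atTop (4 * c)).and
    (eventually_ge_atTop s₀))
  refine tendsto_atTop.2 fun B => ?_
  obtain ⟨s₂, hs₂, hB⟩ : ∃ s, s₁ ≤ s ∧ B ≤ y s := by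
    by_contra! hcon
    obtain ⟨X, hX, δ, hδ, hF⟩ := exists_le_nuVelocity hl hc hm
    obtain ⟨s₂, hs₂⟩ := eventually_atTop.1 ((hinf.eventually_ge_atTop (X ^ 2 + 2 * B ^ 2)).and
      (eventually_ge_atTop s₁))
    obtain ⟨s, hs, h⟩ := exists_lt_of_le_hasDerivAt hδ (s₀ := s₂) (fun s _ => hy s)
      (fun s hs => by
        have h1 := (hs₂ s hs).1
        have h2 := hcon s (hs₂ s hs).2
        have h3 := hypos s (hs₁ s (hs₂ s hs).2).2
        have h4 := hpos s (hs₁ s (hs₂ s hs).2).2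
        have h5 : y s ^ 2 ≤ B ^ 2 := by gcongr
        refine hF _ _ ?_ ?_
        · exact le_of_sq_le_sq (by nlinarith) h4.le
        · rw [abs_of_pos h3]
          exact le_of_sq_le_sq (by nlinarith) h4.le) B
    exact (hcon s (hs₂ s hs).2).not_gt h
  filter_upwards [eventually_ge_atTop s₂] with s hs
  exact hB.trans (le_of_hasDerivAt_nonneg (fun s _ => hy s)
    (fun s hs => nuVelocity_nonneg hl hc hm (hpos s (hs₁ s hs).2) (hypos s (hs₁ s hs).2)
      (hs₁ s hs).1) hs₂ hs)

theorem tendsto_tau_of_pos (hl : 0 < l) (hc : 0 < c) (hm : 0 < m)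
    (hx : ∀ s, HasDerivAt x (tauVelocity l c m (x s) (y s)) s)
    (hy : ∀ s, HasDerivAt y (nuVelocity l c m (x s) (y s)) s) {s₀ : ℝ}
    (hpos : ∀ s, s₀ ≤ s → 0 < x s) (hypos : ∀ s, s₀ ≤ s → 0 < y s) :
    Tendsto x atTop (nhds 0) := by
  have hinf := tendsto_sq_add_sq hl hc hm hx hy hpos
  have hyinf := tendsto_nu_of_pos hl hc hm hx hy hpos hypos
  have hneg : ∀ s, s₀ ≤ s → m ≤ x s * y s → tauVelocity l c m (x s) (y s) < 0 := by
    intro s hs h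
    refine (tauVelocity_le_of_le_mul hl hc hm h).trans_lt (neg_lt_zero.2 ?_)
    have := supportDenom_pos hl hc (x s) (y s)
    have := hm.trans_le h
    positivity
  refine Metric.tendsto_atTop.2 fun ε hε => ?_
  obtain ⟨s₁, hs₁⟩ := eventually_atTop.1 ((hyinf.eventually_ge_atTop (2 * m / ε)).and
    (eventually_ge_atTop s₀))
  have hmul : ∀ s, s₁ ≤ s → ε / 2 ≤ x s → m ≤ x s * y s := by
    intro s hs h
    calc m = ε / 2 * (2 * m / ε) := by field_simp
      _ ≤ x s * y s := mul_le_mul h (hs₁ s hs).1 (by positivity) (by linarith)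
  obtain ⟨s₂, hs₂, hlt⟩ : ∃ s, s₁ ≤ s ∧ x s ≤ ε / 2 := by
    by_contra! hcon
    have hM : ∀ s, s₁ ≤ s → x s ≤ x s₁ := fun s hs => by
      have := le_of_hasDerivAt_nonneg (f := fun s => -x s) (s₀ := s₁) (fun s _ => (hx s).neg)
        (fun s hs => by linarith [hneg s (hs₁ s hs).2 (hmul s hs (hcon s hs).le)]) le_rfl hs
      linarith
    obtain ⟨s₂, hs₂⟩ := eventually_atTop.1 ((hyinf.eventually_ge_atTop (max 1 (x s₁))).and
      (eventually_ge_atTop s₁))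
    set κ := l / (4 * m * (4 + l * (4 * c ^ 2 + 1))) with hκ
    have hκ0 : 0 < κ := by positivity
    have hmono : ∀ s, s₂ ≤ s →
        (x s₂)⁻¹ - κ * Real.log (x s₂ ^ 2 + y s₂ ^ 2) ≤
          (x s)⁻¹ - κ * Real.log (x s ^ 2 + y s ^ 2) := fun s hs =>
      le_of_hasDerivAt_nonneg (f := fun s => (x s)⁻¹ - κ * Real.log (x s ^ 2 + y s ^ 2))
        (fun s hs => ((hx s).inv (hpos s (hs₁ s (hs₂ s hs).2).2).ne').sub
          ((hasDerivAt_log_sq_add_sq hl hc hm hx hy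
            (hpos s (hs₁ s (hs₂ s hs).2).2)).const_mul κ))
        (fun s hs => by
          have hs' := (hs₂ s hs).2
          have hp := hpos s (hs₁ s hs').2
          have h1 := le_div_supportDenom hl hc hm hp ((le_max_left _ _).trans (hs₂ s hs).1)
            ((hM s hs').trans ((le_max_right _ _).trans (hs₂ s hs).1))
          have h2 := tauVelocity_le_of_le_mul hl hc hm (hmul s hs' (hcon s hs').le)
          have h3 := div_le_div_of_nonneg_right (le_neg_of_le_neg h2) (sq_nonneg (x s))
          linarith) le_rfl hs
    have hlog := (Real.tendsto_log_atTop.comp hinf).const_mul_atTop hκ0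
    obtain ⟨s, hs, hss⟩ := ((hlog.eventually_gt_atTop
      ((ε / 2)⁻¹ + κ * Real.log (x s₂ ^ 2 + y s₂ ^ 2))).and (eventually_ge_atTop s₂)).exists
    have h1 := hmono s hss
    have h2 := inv_pos.2 (hpos s₂ (hs₁ s₂ (hs₂ s₂ le_rfl).2).2)
    have h3 : (x s)⁻¹ ≤ (ε / 2)⁻¹ := inv_anti₀ (by positivity) (hcon s (hs₂ s hss).2).le
    simp only [Function.comp] at hs
    linarith
  refine ⟨s₂, fun s hs => ?_⟩
  have hle : -(ε / 2) ≤ -x s :=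
    le_of_hasDerivAt_pos_of_eq (f := fun s => -x s) (fun s _ => (hx s).neg) (by linarith)
      (fun s hs e => by
        have := hneg s (hs₁ s (hs₂.trans hs)).2 (hmul s (hs₂.trans hs) (by linarith))
        linarith) hs
  rw [Real.dist_eq, sub_zero, abs_of_pos (hpos s (hs₁ s (hs₂.trans hs)).2)]
  linarith

theorem tendsto_tau_nu_atTop (hl : 0 < l) (hc : 0 < c) (hm : 0 < m)
    (hx : ∀ s, HasDerivAt x (tauVelocity l c m (x s) (y s)) s)
    (hy : ∀ s, HasDerivAt y (nuVelocity l c m (x s) (y s)) s) :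
    Tendsto x atTop (nhds 0) ∧ Tendsto y atTop atTop := by
  obtain ⟨s₀, hs₀⟩ := exists_tau_pos hl hc hm hx hy
  have hpos : ∀ s, s₀ ≤ s → 0 < x s := fun s hs => by
    rcases hs.eq_or_lt with rfl | hs
    · exact hs₀
    · exact lt_of_hasDerivAt_pos_of_eq (fun s _ => hx s) hs₀.le
        (fun s _ e => tauVelocity_pos hl hc hm (by rw [e, zero_mul])) hs
  obtain ⟨s₁, hs₁, hy₁⟩ := exists_nu_nonneg hl hc hm hx hy hpos
  have hypos : ∀ s, s₁ + 1 ≤ s → 0 < y s := fun s hs =>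
    lt_of_hasDerivAt_pos_of_eq (s₀ := s₁) (fun s _ => hy s) hy₁
      (fun s hs e => by rw [e]; exact nuVelocity_pos hl hc hm (hpos s (hs₁.trans hs)))
      (by linarith)
  have hpos' : ∀ s, s₁ + 1 ≤ s → 0 < x s := fun s hs => hpos s (by linarith)
  exact ⟨tendsto_tau_of_pos hl hc hm hx hy hpos' hypos,
    tendsto_nu_of_pos hl hc hm hx hy hpos' hypos⟩

end Solution

theorem one_add_helicoidalCurvature_mul_s19 {lam c : ℝ} (hlam : 0 < lam) (hc : 0 < c) (x y : ℝ) :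
    1 + helicoidalCurvature lam c x y * y = tauVelocity lam c (Real.sqrt lam * c) x y := by
  have hD := supportDenom_pos hlam hc x y
  have ha : 0 < Real.sqrt lam := Real.sqrt_pos.2 hlam
  have h2 : lam = Real.sqrt lam ^ 2 := (Real.sq_sqrt hlam.le).symm
  unfold helicoidalCurvature tauVelocity
  change 1 + _ / (_ * supportDenom lam c x y) * y = _
  rw [div_mul_eq_mul_div, ← div_self (a := Real.sqrt lam * c * supportDenom lam c x y)
    (by positivity), ← add_div]
  congr 1
  unfold supportDenom supportAxis
  generalize Real.sqrt lam = a at *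
  subst h2
  ring

theorem neg_helicoidalCurvature_mul {lam c : ℝ} (hlam : 0 < lam) (x y : ℝ) :
    -helicoidalCurvature lam c x y * x = nuVelocity lam c (Real.sqrt lam * c) x y := by
  have h2 : lam = Real.sqrt lam ^ 2 := (Real.sq_sqrt hlam.le).symm
  unfold helicoidalCurvature nuVelocity
  change -(_ / (_ * supportDenom lam c x y)) * x = _
  rw [← neg_div, div_mul_eq_mul_div]
  congr 1
  unfold supportAxis
  generalize Real.sqrt lam = a at *
  subst h2
  ring

theorem tauVelocity_neg_neg (l c m x y : ℝ) :
    tauVelocity l c m (-x) (-y) = tauVelocity l c m x y := by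
  simp only [tauVelocity, supportAxis, supportDenom, neg_sq, neg_mul_neg]

theorem nuVelocity_neg_neg (l c m x y : ℝ) :
    nuVelocity l c m (-x) (-y) = nuVelocity l c m x y := by
  simp only [nuVelocity, supportAxis, supportDenom, neg_sq, neg_mul_neg]

/-- Along a global solution of `τ' = 1 + kν`, `ν' = −kτ`, the support function `τ` has a
finite limit in each direction, while `ν → +∞` as `s → +∞` and `ν → −∞` as `s → −∞`. -/
theorem helicoidal_tau_nu_limits
    (lam c : ℝ) (hlam : 0 < lam) (hc : 0 < c) (τ ν : ℝ → ℝ)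
    (hτ : ∀ s : ℝ, HasDerivAt τ (1 + helicoidalCurvature lam c (τ s) (ν s) * ν s) s)
    (hν : ∀ s : ℝ, HasDerivAt ν (-(helicoidalCurvature lam c (τ s) (ν s)) * τ s) s) :
    (∃ Lp : ℝ, Filter.Tendsto τ Filter.atTop (nhds Lp)) ∧
    (∃ Lm : ℝ, Filter.Tendsto τ Filter.atBot (nhds Lm)) ∧
    Filter.Tendsto ν Filter.atTop Filter.atTop ∧
    Filter.Tendsto ν Filter.atBot Filter.atBot := by
  simp only [one_add_helicoidalCurvature_mul_s19 hlam hc] at hτ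
  simp only [neg_helicoidalCurvature_mul hlam] at hν
  have hm : 0 < Real.sqrt lam * c := mul_pos (Real.sqrt_pos.2 hlam) hc
  obtain ⟨hp, hp'⟩ := tendsto_tau_nu_atTop hlam hc hm hτ hν
  have hrev : ∀ (f : ℝ → ℝ) (f' s : ℝ), HasDerivAt f f' (-s) →
      HasDerivAt (fun s => -f (-s)) f' s := fun f f' s h => by
    have := (h.comp s (hasDerivAt_neg s)).neg
    rwa [mul_neg_one, neg_neg] at this
  obtain ⟨hn, hn'⟩ := tendsto_tau_nu_atTop (x := fun s => -τ (-s)) (y := fun s => -ν (-s))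
    hlam hc hm
    (fun s => by rw [tauVelocity_neg_neg]; exact hrev _ _ _ (hτ (-s)))
    (fun s => by rw [nuVelocity_neg_neg]; exact hrev _ _ _ (hν (-s)))
  refine ⟨⟨0, hp⟩, ⟨0, ?_⟩, hp', ?_⟩
  · simpa [Function.comp_def] using (hn.comp tendsto_neg_atBot_atTop).neg
  · simpa [Function.comp_def] using
      tendsto_neg_atTop_atBot.comp (hn'.comp tendsto_neg_atBot_atTop)
end
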